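/- Let [a,b] ⊆ (0,1] with u_h(γ) ≥ κ_S for all γ ∈ [a,b], and suppose there is an index p such that u_h(γ) = γR_p − c_p for all γ ∈ [a,b] (i.e., u_h is affine on [a,b]). Then the inspection threshold β(·) is convex on [a,b]; moreover, β is strictly convex on any subinterval of [a,b] on which β > 0. -/

import Mathlib

/-- The upper envelope function `u_h(γ) = max_j (γ R_j - c_j)`. -/
noncomputable def uh (n : ℕ) (hn : 0 < n) (R c : Fin n → ℝ) (γ : ℝ) : ℝ :=
  Finset.univ.sup' (Finset.univ_nonempty_iff.mpr (Fin.pos_iff_nonempty.mp hn))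
    (fun j => γ * R j - c j)

/-- The inspection threshold `β(γ) = max{1 - δ(γ)/(γ(1-α)), 0}`. -/
noncomputable def betaFn (α : ℝ) (δ : ℝ → ℝ) (γ : ℝ) : ℝ :=
  max (1 - δ γ / (γ * (1 - α))) 0

theorem le_uh (n : ℕ) (hn : 0 < n) (R c : Fin n → ℝ) (γ : ℝ) (j : Fin n) :
    γ * R j - c j ≤ uh n hn R c γ :=
  Finset.le_sup' (fun j => γ * R j - c j) (Finset.mem_univ j)

theorem exists_uh_eq (n : ℕ) (hn : 0 < n) (R c : Fin n → ℝ) (γ : ℝ) :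
    ∃ j, uh n hn R c γ = γ * R j - c j := by
  obtain ⟨j, -, hj⟩ := Finset.exists_mem_eq_sup'
    (Finset.univ_nonempty_iff.mpr (Fin.pos_iff_nonempty.mp hn)) (fun j => γ * R j - c j)
  exact ⟨j, hj⟩

/-- A function supported from below at every point of a convex set by a strictly convex function
is strictly convex. -/
theorem strictConvexOn_of_exists_support {s : Set ℝ} {g : ℝ → ℝ} (hs : Convex ℝ s)
    (h : ∀ z ∈ s, ∃ f : ℝ → ℝ, StrictConvexOn ℝ s f ∧ (∀ x ∈ s, f x ≤ g x) ∧ f z = g z) :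
    StrictConvexOn ℝ s g := by
  refine ⟨hs, fun x hx y hy hxy μ ν hμ hν hμν => ?_⟩
  obtain ⟨f, hf, hle, heq⟩ := h _ (hs hx hy hμ.le hν.le hμν)
  rw [← heq]
  refine (hf.2 hx hy hxy hμ hν hμν).trans_le ?_
  simp only [smul_eq_mul]
  gcongr
  exacts [hle x hx, hle y hy]

theorem strictConvexOn_add_mul_inv (A : ℝ) {B : ℝ} (hB : 0 < B) :
    StrictConvexOn ℝ (Set.Ioi 0) (fun x : ℝ => A + B * x⁻¹) := by
  have h : StrictConvexOn ℝ (Set.Ioi (0 : ℝ)) (fun x : ℝ => x ^ (-1 : ℤ)) :=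
    strictConvexOn_zpow (by norm_num) (by norm_num)
  refine ⟨convex_Ioi 0, fun x hx y hy hxy μ ν hμ hν hμν => ?_⟩
  have key := mul_lt_mul_of_pos_left (h.2 hx hy hxy hμ hν hμν) hB
  simp only [smul_eq_mul, zpow_neg_one] at key ⊢
  linear_combination key - A * hμν

/-- on a segment `[a,b] ⊆ (0,1]` where `u_h` is affine (given by
action `p`), the inspection threshold `β(·)` is convex, and strictly convex on
any subinterval of `[a,b]` on which it is positive. -/
theorem betaFn_convex
    (n : ℕ) (hn : 0 < n) (R c : Fin n → ℝ)
    (hc0 : 0 ≤ c ⟨0, hn⟩) (hc : StrictMono c)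
    (hR0 : 0 < R ⟨0, hn⟩) (hR : StrictMono R)
    (κS : ℝ) (hκS : 0 < κS) (α : ℝ) (hα0 : 0 < α) (hα1 : α < 1)
    (δ : ℝ → ℝ)
    (hδ : ∀ γ ∈ Set.Ioc (0 : ℝ) 1, κS ≤ uh n hn R c γ →
      δ γ ∈ Set.Icc 0 γ ∧ uh n hn R c (δ γ) = uh n hn R c γ - κS)
    (a b : ℝ) (ha : 0 < a) (hb : b ≤ 1)
    (hκ : ∀ γ ∈ Set.Icc a b, κS ≤ uh n hn R c γ)
    (p : Fin n)
    (hp : ∀ γ ∈ Set.Icc a b, uh n hn R c γ = γ * R p - c p) :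
    ConvexOn ℝ (Set.Icc a b) (betaFn α δ) ∧
    ∀ a' b', a ≤ a' → b' ≤ b → (∀ γ ∈ Set.Icc a' b', 0 < betaFn α δ γ) →
      StrictConvexOn ℝ (Set.Icc a' b') (betaFn α δ) := by
  have hα : 0 < 1 - α := sub_pos.mpr hα1
  have hRpos : ∀ j, 0 < R j := fun j => hR0.trans_le (hR.monotone (Fin.mk_le_of_le_val j.1.zero_le))
  have hδ' : ∀ γ ∈ Set.Icc a b, δ γ ∈ Set.Icc 0 γ ∧
      uh n hn R c (δ γ) = γ * R p - c p - κS := fun γ hγ => by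
    rw [← hp γ hγ]
    exact hδ γ ⟨ha.trans_le hγ.1, hγ.2.trans hb⟩ (hκ γ hγ)
  have strict : StrictConvexOn ℝ (Set.Icc a b) (fun γ => 1 - δ γ / (γ * (1 - α))) := by
    refine strictConvexOn_of_exists_support (convex_Icc a b) fun z hz => ?_
    obtain ⟨⟨-, hδz⟩, huz⟩ := hδ' z hz
    obtain ⟨j, hj⟩ := exists_uh_eq n hn R c (δ z)
    have hcj : c j < c p + κS := by
      have h₁ := le_uh n hn R c (δ z) p
      have h₂ := le_uh n hn R c z j
      rw [hp z hz] at h₂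
      by_contra! hlt
      have hRj : R p < R j := hR (hc.lt_iff_lt.mp (by linarith))
      have hδz' : δ z ≠ z := fun h => by
        rw [h, hp z hz] at huz
        linarith
      nlinarith [mul_pos (sub_pos.mpr (lt_of_le_of_ne hδz hδz')) (sub_pos.mpr hRj)]
    have hRj := hRpos j
    have hform : ∀ x ∈ Set.Icc a b,
        1 - R p / (R j * (1 - α)) + (c p + κS - c j) / (R j * (1 - α)) * x⁻¹ =
          1 - (x * R p - c p - κS + c j) / R j / (x * (1 - α)) := fun x hx => by
      have hx0 : 0 < x := ha.trans_le hx.1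
      field_simp
      ring
    refine ⟨fun x => 1 - R p / (R j * (1 - α)) + (c p + κS - c j) / (R j * (1 - α)) * x⁻¹,
      (strictConvexOn_add_mul_inv _ (div_pos (sub_pos.mpr hcj) (mul_pos hRj hα))).subset
        (fun x hx => ha.trans_le hx.1) (convex_Icc a b), fun x hx => ?_, ?_⟩
    · have hx0 : 0 < x := ha.trans_le hx.1
      have hle := le_uh n hn R c (δ x) j
      rw [(hδ' x hx).2] at hle
      simp only [hform x hx]
      gcongr
      rw [le_div_iff₀ hRj]
      linarith
    · have hδeq : (z * R p - c p - κS + c j) / R j = δ z := by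
        rw [div_eq_iff hRj.ne']
        linarith
      simp only [hform z hz, hδeq]
  refine ⟨strict.convexOn.sup (convexOn_const 0 (convex_Icc a b)), fun a' b' ha' hb' hpos => ?_⟩
  refine (strict.subset (Set.Icc_subset_Icc ha' hb') (convex_Icc a' b')).congr fun γ hγ => ?_
  have h := hpos γ hγ
  rw [betaFn, lt_max_iff, or_iff_left (lt_irrefl 0)] at h
  exact (max_eq_left h.le).symm
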